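/- Let B be the unital associative ℤ[δ,δ⁻¹]-algebra with generators x_2,x_3,x_4,f_2,f_3,f_4 subject to precisely those defining relations of Br(F4) that involve only the indices 2, 3, 4 (with x_i in place of r_i and f_i in place of e_i); this algebra is isomorphic to the Brauer algebra Br(B3) of type B3. Then the canonical ℤ[δ,δ⁻¹]-algebra homomorphism B → Br(F4) sending x_i ↦ r_i and f_i ↦ e_i (i = 2,3,4) is injective. -/

import Mathlib

open LaurentPolynomial

/-- The base ring `ℤ[δ, δ⁻¹]` of Laurent polynomials over `ℤ`. -/
abbrev Rring : Type := LaurentPolynomial ℤ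

/-- The distinguished invertible element `δ`. -/
noncomputable def δ : Rring := LaurentPolynomial.T 1

/-- Generators of the Brauer algebra of type F₄: `r i` and `e i` for the four nodes
(the node `i : Fin 4` corresponds to the node `i+1` in the usual 1-based labelling). -/
inductive GenF4 : Type
  | r : Fin 4 → GenF4
  | e : Fin 4 → GenF4

namespace BrF4rel

/-- `R i` in the free algebra. -/
noncomputable abbrev R (i : Fin 4) : FreeAlgebra Rring GenF4 := FreeAlgebra.ι Rring (GenF4.r i)
/-- `E i` in the free algebra. -/
noncomputable abbrev E (i : Fin 4) : FreeAlgebra Rring GenF4 := FreeAlgebra.ι Rring (GenF4.e i)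

/-- Non-adjacent (0-based) pairs of nodes of the F₄ diagram: `{1,3}, {1,4}, {2,4}` 1-based. -/
def nadj (i j : Fin 4) : Prop :=
  (i, j) ∈ ([(0, 2), (2, 0), (0, 3), (3, 0), (1, 3), (3, 1)] : List (Fin 4 × Fin 4))

/-- Simply bonded (0-based) pairs of nodes of the F₄ diagram: `{1,2}, {3,4}` 1-based. -/
def sadj (i j : Fin 4) : Prop :=
  (i, j) ∈ ([(0, 1), (1, 0), (2, 3), (3, 2)] : List (Fin 4 × Fin 4))

/-- The defining relations of the Brauer algebra of type F₄ (0-based node labels: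
node `i` here is node `i+1` in the paper). -/
inductive rel : FreeAlgebra Rring GenF4 → FreeAlgebra Rring GenF4 → Prop
  | rr (i : Fin 4) : rel (R i * R i) 1
  | re (i : Fin 4) : rel (R i * E i) (E i)
  | er (i : Fin 4) : rel (E i * R i) (E i)
  | ee_short (i : Fin 4) (h : i = 2 ∨ i = 3) : rel (E i * E i) (δ • E i)
  | ee_long (i : Fin 4) (h : i = 0 ∨ i = 1) : rel (E i * E i) ((δ ^ 2) • E i)
  | rr_comm {i j : Fin 4} (h : nadj i j) : rel (R i * R j) (R j * R i)
  | er_comm {i j : Fin 4} (h : nadj i j) : rel (E i * R j) (R j * E i)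
  | ee_comm {i j : Fin 4} (h : nadj i j) : rel (E i * E j) (E j * E i)
  | braid {i j : Fin 4} (h : sadj i j) : rel (R i * R j * R i) (R j * R i * R j)
  | rre {i j : Fin 4} (h : sadj i j) : rel (R j * R i * E j) (E i * E j)
  | rer {i j : Fin 4} (h : sadj i j) : rel (R i * E j * R i) (R j * E i * R j)
  | db1 : rel (R 1 * R 2 * R 1 * R 2) (R 2 * R 1 * R 2 * R 1)
  | db2 : rel (R 1 * R 2 * E 1) (R 2 * E 1)
  | db3 : rel (R 1 * E 2 * R 1 * E 2) (E 2 * E 1 * E 2)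
  | db4 : rel (R 1 * R 2 * R 1 * E 2) (E 2 * (R 1 * R 2 * R 1))
  | db5 : rel (E 1 * R 2 * E 1) (δ • E 1)
  | db6 : rel (E 1 * E 2 * E 1) (δ • E 1)
  | db7 : rel (E 1 * R 2 * R 1) (E 1 * R 2)
  | db8 : rel (E 1 * E 2 * R 1) (E 1 * E 2)

end BrF4rel

/-- The Brauer algebra of type F₄ over `ℤ[δ, δ⁻¹]`. -/
noncomputable abbrev BrF4 : Type := RingQuot BrF4rel.rel

/-- The generator `r i` (0-based) of `BrF4`. -/
noncomputable def rgen (i : Fin 4) : BrF4 :=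
  RingQuot.mkAlgHom Rring BrF4rel.rel (BrF4rel.R i)

/-- The generator `e i` (0-based) of `BrF4`. -/
noncomputable def egen (i : Fin 4) : BrF4 :=
  RingQuot.mkAlgHom Rring BrF4rel.rel (BrF4rel.E i)

/-- Generators `x i`, `f i` (`i = 0,1,2` standing for the 1-based F₄ indices `2,3,4`)
of the subalgebra of type B₃. -/
inductive GenB3 : Type
  | x : Fin 3 → GenB3
  | f : Fin 3 → GenB3

namespace BrB3rel

noncomputable abbrev X (i : Fin 3) : FreeAlgebra Rring GenB3 := FreeAlgebra.ι Rring (GenB3.x i)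
noncomputable abbrev F (i : Fin 3) : FreeAlgebra Rring GenB3 := FreeAlgebra.ι Rring (GenB3.f i)

/-- Precisely the defining relations of `Br(F₄)` involving only the (1-based) indices `2,3,4`,
with `x_i` in place of `r_i` and `f_i` in place of `e_i`; here the local label `i : Fin 3`
stands for the F₄ index `i+2` (1-based). -/
inductive rel : FreeAlgebra Rring GenB3 → FreeAlgebra Rring GenB3 → Prop
  | xx (i : Fin 3) : rel (X i * X i) 1
  | xf (i : Fin 3) : rel (X i * F i) (F i)
  | fx (i : Fin 3) : rel (F i * X i) (F i)
  | ff_short1 : rel (F 1 * F 1) (δ • F 1)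
  | ff_short2 : rel (F 2 * F 2) (δ • F 2)
  | ff_long : rel (F 0 * F 0) ((δ ^ 2) • F 0)
  | nxx : rel (X 0 * X 2) (X 2 * X 0)
  | nfx : rel (F 0 * X 2) (X 2 * F 0)
  | nxf : rel (F 2 * X 0) (X 0 * F 2)
  | nff : rel (F 0 * F 2) (F 2 * F 0)
  | braid : rel (X 1 * X 2 * X 1) (X 2 * X 1 * X 2)
  | rre12 : rel (X 2 * X 1 * F 2) (F 1 * F 2)
  | rre21 : rel (X 1 * X 2 * F 1) (F 2 * F 1)
  | rer12 : rel (X 1 * F 2 * X 1) (X 2 * F 1 * X 2)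
  | db1 : rel (X 0 * X 1 * X 0 * X 1) (X 1 * X 0 * X 1 * X 0)
  | db2 : rel (X 0 * X 1 * F 0) (X 1 * F 0)
  | db3 : rel (X 0 * F 1 * X 0 * F 1) (F 1 * F 0 * F 1)
  | db4 : rel (X 0 * X 1 * X 0 * F 1) (F 1 * (X 0 * X 1 * X 0))
  | db5 : rel (F 0 * X 1 * F 0) (δ • F 0)
  | db6 : rel (F 0 * F 1 * F 0) (δ • F 0)
  | db7 : rel (F 0 * X 1 * X 0) (F 0 * X 1)
  | db8 : rel (F 0 * F 1 * X 0) (F 0 * F 1)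

end BrB3rel

/-- The algebra `B` presented by the relations of `Br(F₄)` involving only indices `2,3,4`;
it is isomorphic to the Brauer algebra of type B₃. -/
noncomputable abbrev BrB3 : Type := RingQuot BrB3rel.rel

noncomputable def xgen (i : Fin 3) : BrB3 := RingQuot.mkAlgHom Rring BrB3rel.rel (BrB3rel.X i)
noncomputable def fgen (i : Fin 3) : BrB3 := RingQuot.mkAlgHom Rring BrB3rel.rel (BrB3rel.F i)

/-! ### Certified rewriting of words

Words in the generators of `BrB3` are lists of natural numbers; the letters `0, 1, 2` stand for
`x₀, x₁, x₂` and the letters `3, 4, 5` for `f₀, f₁, f₂`. -/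

namespace BrB3

/-- The rewriting rule replacing the word `lhs` by `δ ^ exp` times the word `rhs`. -/
structure Rule where
  lhs : List ℕ
  exp : ℤ
  rhs : List ℕ

/-- The word that remains when the prefix `l` is removed from `w`. -/
def stripPrefix : List ℕ → List ℕ → Option (List ℕ)
  | [], w => some w
  | _ :: _, [] => none
  | a :: l, b :: w => bif a.beq b then stripPrefix l w else none

/-- The first rule whose left-hand side is a prefix of `w`, with the remaining part of `w`. -/
def matchHead : List Rule → List ℕ → Option (Rule × List ℕ)
  | [], _ => none
  | r :: rs, w =>
    match stripPrefix r.lhs w with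
    | some rest => some (r, rest)
    | none => matchHead rs w

/-- Prepend a letter to `δ ^ k • w` and rewrite at the head of the word, with bounded depth. -/
def push (rs : List Rule) : ℕ → ℕ → ℤ × List ℕ → ℤ × List ℕ
  | 0, g, p => (p.1, g :: p.2)
  | n + 1, g, p =>
    match matchHead rs (g :: p.2) with
    | none => (p.1, g :: p.2)
    | some q => q.1.rhs.foldr (push rs n) (p.1 + q.1.exp, q.2)

/-- Rewrite a word from right to left. -/
def normalize (rs : List Rule) (w : List ℕ) : ℤ × List ℕ :=
  w.foldr (push rs 50) (0, [])

/-- A numerical weight which, on words of equal length, is a lexicographic order. -/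
def weight (w : List ℕ) : ℕ :=
  w.foldl (fun a g => 6 * a + (6 - g)) 0

/-- Add the rule obtained by completing the overlap of the `p.1`-th rule, extended on the right
by the word `p.2`, with the other rules. -/
def complete (rs : List Rule) (p : ℕ × List ℕ) : List Rule :=
  match rs[p.1]? with
  | none => rs
  | some r =>
    let u := normalize rs (r.lhs ++ p.2)
    let v := normalize rs (r.rhs ++ p.2)
    bif Nat.ble (weight u.2) (weight v.2) then ⟨v.2, u.1 - (v.1 + r.exp), u.2⟩ :: rs
    else ⟨u.2, v.1 + r.exp - u.1, v.2⟩ :: rs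

/-- The defining relations of `BrB3`, oriented. -/
def baseRules : List Rule :=
  [⟨[0, 0], 0, []⟩, ⟨[0, 3], 0, [3]⟩, ⟨[3, 0], 0, [3]⟩, ⟨[3, 3], 2, [3]⟩,
   ⟨[1, 1], 0, []⟩, ⟨[1, 4], 0, [4]⟩, ⟨[4, 1], 0, [4]⟩, ⟨[4, 4], 1, [4]⟩,
   ⟨[2, 2], 0, []⟩, ⟨[2, 5], 0, [5]⟩, ⟨[5, 2], 0, [5]⟩, ⟨[5, 5], 1, [5]⟩,
   ⟨[0, 2], 0, [2, 0]⟩, ⟨[2, 3], 0, [3, 2]⟩, ⟨[3, 5], 0, [5, 3]⟩, ⟨[0, 5], 0, [5, 0]⟩,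
   ⟨[1, 2, 1], 0, [2, 1, 2]⟩, ⟨[2, 1, 5], 0, [4, 5]⟩, ⟨[1, 5, 1], 0, [2, 4, 2]⟩,
   ⟨[1, 2, 4], 0, [5, 4]⟩, ⟨[0, 1, 0, 1], 0, [1, 0, 1, 0]⟩, ⟨[0, 1, 3], 0, [1, 3]⟩,
   ⟨[0, 4, 0, 4], 0, [4, 3, 4]⟩, ⟨[0, 1, 0, 4], 0, [4, 0, 1, 0]⟩, ⟨[3, 1, 3], 1, [3]⟩,
   ⟨[3, 4, 3], 1, [3]⟩, ⟨[3, 1, 0], 0, [3, 1]⟩, ⟨[3, 4, 0], 0, [3, 4]⟩]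

/-- The overlaps to be completed successively in order to make `baseRules` confluent. -/
def overlaps : List (ℕ × List ℕ) :=
  [(4, [5, 1]), (11, [3]), (12, [1, 5]), (20, [1]), (10, [2, 4]), (7, [2]), (14, [1, 5]), (11,
   [2, 4]), (27, [5]), (8, [2]), (27, [4]), (7, [1]), (11, [3]), (27, [4, 5]), (28, [4, 2]),
   (29, [1, 5]), (30, [1, 2]), (7, [3]), (33, [4, 5]), (34, [4, 2]), (35, [1, 5]), (36, [1, 2]),
   (47, [5]), (50, [5]), (51, [2]), (38, [4, 3]), (39, [4, 0]), (40, [1, 3]), (41, [1, 0]), (53,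
   [5]), (56, [5]), (57, [2]), (44, [4, 5]), (45, [1, 5]), (55, [5]), (1, [3]), (23, [0, 4, 5]),
   (24, [0, 1, 5]), (37, [0, 4, 5]), (38, [0, 1, 5]), (53, [4, 2, 0]), (54, [1, 2, 0]), (65, [5,
   4]), (66, [5, 1]), (67, [2, 4]), (68, [2, 1]), (66, [5, 4]), (67, [2, 4]), (68, [5, 1]), (69,
   [2, 1]), (28, [0, 1, 2]), (47, [0, 1, 2, 0, 4]), (68, [0, 1, 5, 0, 4]), (3, [0, 1, 2, 0, 4]),
   (58, [0, 4, 5, 0, 4]), (1, [2]), (52, [0, 4, 2, 0, 4]), (53, [0, 1, 2, 0, 1]), (74, [0, 4, 5,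
   0, 4]), (37, [0, 4, 2, 0, 4]), (49, [0, 4]), (83, []), (0, [3]), (8, [2, 0, 1, 2, 0, 1]), (0,
   [2]), (1, [1]), (46, [0, 1, 2]), (63, [0, 4, 2, 0, 1])]

/-- A rewriting system for `BrB3` with `273` irreducible words. -/
def rules : List Rule := overlaps.foldl complete baseRules

/-- The words of length `n` containing no left-hand side of a rule. -/
def normalWords (rs : List Rule) : ℕ → List (List ℕ)
  | 0 => [[]]
  | n + 1 => (normalWords rs n).flatMap fun w =>
      ((List.range 6).map (· :: w)).filter fun w => (matchHead rs w).isNone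

/-- The irreducible words. -/
def basisWords : List (List ℕ) := (List.range 10).flatMap (normalWords rules)

/-- The conditions on a rule which make rewriting with it terminate. -/
def Rule.decreasing (r : Rule) : Bool :=
  r.rhs.length.ble r.lhs.length && (weight r.rhs).blt (weight r.lhs) && r.rhs.all (Nat.blt · 6)

theorem rules_decreasing : (rules.all Rule.decreasing) = true := by
  decide +kernel

theorem normalWords_ten : normalWords rules 10 = [] := by
  decide +kernel

theorem stripPrefix_eq_some {l w rest : List ℕ} (h : stripPrefix l w = some rest) :
    w = l ++ rest := by
  induction l generalizing w with
  | nil => simpa [stripPrefix] using h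
  | cons a l ih =>
    cases w with
    | nil => simp [stripPrefix] at h
    | cons b w =>
      simp only [stripPrefix] at h
      cases hab : a.beq b with
      | false => simp [hab] at h
      | true =>
        rw [hab, cond_true] at h
        rw [Nat.eq_of_beq_eq_true hab, ih h, List.cons_append]

theorem matchHead_eq_some {rs : List Rule} {w : List ℕ} {q : Rule × List ℕ}
    (h : matchHead rs w = some q) : q.1 ∈ rs ∧ w = q.1.lhs ++ q.2 := by
  induction rs with
  | nil => simp [matchHead] at h
  | cons r rs ih =>
    rw [matchHead] at h
    split at h
    · next rest hr =>
      cases h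
      exact ⟨List.mem_cons_self, stripPrefix_eq_some hr⟩
    · exact (ih h).imp_left (List.mem_cons_of_mem r)

/-- The generator of `BrB3` encoded by a letter. -/
noncomputable def letter : ℕ → BrB3
  | 0 => xgen 0
  | 1 => xgen 1
  | 2 => xgen 2
  | 3 => fgen 0
  | 4 => fgen 1
  | _ => fgen 2

/-- The element of `BrB3` represented by a word. -/
noncomputable def eval (w : List ℕ) : BrB3 := (w.map letter).prod

theorem eval_cons (g : ℕ) (w : List ℕ) : eval (g :: w) = letter g * eval w := by
  simp [eval]

theorem eval_append (u w : List ℕ) : eval (u ++ w) = eval u * eval w := by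
  simp [eval]

/-- A rule holds if its two sides represent the same element of `BrB3`. -/
def Rule.Holds (r : Rule) : Prop := eval r.lhs = (T r.exp : Rring) • eval r.rhs

/-- The element of `BrB3` represented by a word with a power of `δ` as coefficient. -/
noncomputable def evalPair (p : ℤ × List ℕ) : BrB3 := (T p.1 : Rring) • eval p.2

theorem evalPair_cons (k : ℤ) (g : ℕ) (w : List ℕ) :
    evalPair (k, g :: w) = letter g * evalPair (k, w) := by
  simp [evalPair, eval_cons]

theorem evalPair_foldr {f : ℕ → ℤ × List ℕ → ℤ × List ℕ}
    (hf : ∀ g p, evalPair (f g p) = letter g * evalPair p) (u : List ℕ) (p : ℤ × List ℕ) :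
    evalPair (u.foldr f p) = eval u * evalPair p := by
  induction u with
  | nil => simp [eval]
  | cons g u ih => rw [List.foldr_cons, hf, ih, eval_cons, mul_assoc]

theorem evalPair_push {rs : List Rule} (hrs : ∀ r ∈ rs, r.Holds) (n g : ℕ) (p : ℤ × List ℕ) :
    evalPair (push rs n g p) = letter g * evalPair p := by
  induction n generalizing g p with
  | zero => exact evalPair_cons ..
  | succ n ih =>
    rw [push]
    split
    · exact evalPair_cons ..
    · next q hq =>
      obtain ⟨hmem, hw⟩ := matchHead_eq_some hq
      rw [evalPair_foldr ih, ← evalPair_cons, evalPair, evalPair, hw, eval_append,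
        show eval q.1.lhs = _ from hrs _ hmem, T_add, mul_smul, smul_mul_assoc, mul_smul_comm,
        mul_smul_comm]

theorem evalPair_normalize {rs : List Rule} (hrs : ∀ r ∈ rs, r.Holds) (w : List ℕ) :
    evalPair (normalize rs w) = eval w := by
  rw [normalize, evalPair_foldr (evalPair_push hrs 50)]
  simp [evalPair, eval]

theorem eval_eq_of_evalPair_eq {p q : ℤ × List ℕ} {k : ℤ}
    (h : evalPair p = (T k : Rring) • evalPair q) :
    eval p.2 = (T (k + q.1 - p.1) : Rring) • eval q.2 := by
  have := congrArg (fun a => (T (-p.1) : Rring) • a) h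
  simp only [evalPair, smul_smul, ← T_add] at this
  rw [neg_add_cancel, T_zero, one_smul] at this
  rw [this]
  congr 2
  ring

theorem complete_holds {rs : List Rule} (hrs : ∀ r ∈ rs, r.Holds) (p : ℕ × List ℕ) :
    ∀ r ∈ complete rs p, r.Holds := by
  rw [complete]
  split
  · exact hrs
  · next r hr =>
    have key : evalPair (normalize rs (r.lhs ++ p.2)) =
        (T r.exp : Rring) • evalPair (normalize rs (r.rhs ++ p.2)) := by
      rw [evalPair_normalize hrs, evalPair_normalize hrs, eval_append, eval_append,
        show eval r.lhs = _ from hrs r (List.mem_of_getElem? hr), smul_mul_assoc]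
    have key' : evalPair (normalize rs (r.rhs ++ p.2)) =
        (T (-r.exp) : Rring) • evalPair (normalize rs (r.lhs ++ p.2)) := by
      rw [key, smul_smul, ← T_add, neg_add_cancel, T_zero, one_smul]
    intro s hs
    simp only [Bool.cond_eq_ite] at hs
    split at hs
    · rcases List.mem_cons.1 hs with rfl | hs
      · refine (eval_eq_of_evalPair_eq key').trans ?_
        congr 2
        ring
      · exact hrs s hs
    · rcases List.mem_cons.1 hs with rfl | hs
      · refine (eval_eq_of_evalPair_eq key).trans ?_
        congr 2
        ring
      · exact hrs s hs

theorem mkAlgHom_X (i : Fin 3) : RingQuot.mkAlgHom Rring BrB3rel.rel (BrB3rel.X i) = xgen i := rfl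

theorem mkAlgHom_F (i : Fin 3) : RingQuot.mkAlgHom Rring BrB3rel.rel (BrB3rel.F i) = fgen i := rfl

theorem baseRules_holds : ∀ r ∈ baseRules, r.Holds := by
  have h := @RingQuot.mkAlgHom_rel Rring _ _ _ _ BrB3rel.rel
  have hδ : (T 2 : Rring) = δ ^ 2 := by simp [δ, T_pow]
  have hδ' : (T 1 : Rring) = δ := rfl
  have h1 := fun i => h (.xx i)
  have h2 := fun i => h (.xf i)
  have h3 := fun i => h (.fx i)
  have h4 := h .ff_short1
  have h5 := h .ff_short2
  have h6 := h .ff_long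
  have h7 := h .nxx
  have h8 := h .nfx
  have h9 := h .nxf
  have h10 := h .nff
  have h11 := h .braid
  have h12 := h .rre12
  have h13 := h .rre21
  have h14 := h .rer12
  have h15 := h .db1
  have h16 := h .db2
  have h17 := h .db3
  have h18 := h .db4
  have h19 := h .db5
  have h20 := h .db6
  have h21 := h .db7
  have h22 := h .db8
  simp only [map_mul, map_one, map_smul, mkAlgHom_X, mkAlgHom_F] at h1 h2 h3 h4 h5 h6
  simp only [map_mul, mkAlgHom_X, mkAlgHom_F, mul_assoc] at h7 h8 h9 h10 h11 h12 h13 h14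
  simp only [map_mul, mkAlgHom_X, mkAlgHom_F, mul_assoc] at h15 h16 h17 h18 h21 h22
  simp only [map_mul, map_smul, mkAlgHom_X, mkAlgHom_F, mul_assoc] at h19 h20
  simp only [baseRules, List.forall_mem_cons, Rule.Holds, eval, letter, List.map_cons, List.map_nil,
    List.prod_cons, List.prod_nil, mul_one, T_zero, one_smul, hδ, hδ', List.not_mem_nil,
    false_imp_iff, implies_true, and_true]
  simp [h1, h2, h3, h4, h5, h6, h7, h8, h9, h10, h11, h12, h13, h14, h15, h16, h17, h18, h19, h20,
    h21, h22]

theorem rules_holds : ∀ r ∈ rules, r.Holds := by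
  have h : ∀ (ps : List (ℕ × List ℕ)) (rs : List Rule), (∀ r ∈ rs, r.Holds) →
      ∀ r ∈ ps.foldl complete rs, r.Holds := by
    intro ps
    induction ps with
    | nil => exact fun rs hrs => hrs
    | cons p ps ih => exact fun rs hrs => ih _ (complete_holds hrs p)
  exact h _ _ baseRules_holds

theorem weight_foldl (w : List ℕ) (a : ℕ) :
    w.foldl (fun a g => 6 * a + (6 - g)) a = 6 ^ w.length * a + weight w := by
  induction w generalizing a with
  | nil => simp [weight]
  | cons g w ih =>
    rw [weight, List.foldl_cons, List.foldl_cons, ih, ih (6 * 0 + (6 - g)), List.length_cons]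
    ring

theorem weight_append (u w : List ℕ) :
    weight (u ++ w) = 6 ^ w.length * weight u + weight w := by
  rw [weight, List.foldl_append, weight_foldl w, ← weight]

theorem weight_rewrite_lt {r : Rule} (hr : r.decreasing = true) (u w : List ℕ) :
    weight (u ++ (r.rhs ++ w)) < weight (u ++ (r.lhs ++ w)) := by
  simp only [Rule.decreasing, Bool.and_eq_true, Nat.ble_eq, Nat.blt_eq] at hr
  obtain ⟨⟨hlen, hlt⟩, -⟩ := hr
  simp only [weight_append, List.length_append]
  have h1 : 6 ^ (r.rhs.length + w.length) * weight u ≤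
      6 ^ (r.lhs.length + w.length) * weight u := by gcongr; norm_num
  have h2 : 6 ^ w.length * weight r.rhs < 6 ^ w.length * weight r.lhs := by gcongr
  omega

/-- A word is either listed among the irreducible words or contains a left-hand side. -/
theorem mem_normalWords_or_reducible (rs : List Rule) (w : List ℕ) (hw : ∀ g ∈ w, g < 6) :
    w ∈ normalWords rs w.length ∨ ∃ r ∈ rs, ∃ u v, w = u ++ (r.lhs ++ v) := by
  induction w with
  | nil => exact .inl (by simp [normalWords])
  | cons g w ih =>
    rw [List.forall_mem_cons] at hw
    rcases ih hw.2 with h | ⟨r, hr, u, v, rfl⟩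
    · cases hq : matchHead rs (g :: w) with
      | none =>
        refine .inl (List.mem_flatMap.2 ⟨w, h, List.mem_filter.2 ⟨?_, by simp [hq]⟩⟩)
        exact List.mem_map.2 ⟨g, List.mem_range.2 hw.1, rfl⟩
      | some q =>
        obtain ⟨hmem, h⟩ := matchHead_eq_some hq
        exact .inr ⟨q.1, hmem, [], q.2, h⟩
    · exact .inr ⟨r, hr, g :: u, v, rfl⟩

theorem normalWords_eq_nil {n : ℕ} (hn : 10 ≤ n) : normalWords rules n = [] := by
  induction n, hn using Nat.le_induction with
  | base => exact normalWords_ten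
  | succ n _ ih => rw [normalWords, ih, List.flatMap_nil]

theorem eval_mem_span (w : List ℕ) (hw : ∀ g ∈ w, g < 6) :
    eval w ∈ Submodule.span Rring (Set.range fun i => eval (basisWords.get i)) := by
  induction hn : weight w using Nat.strong_induction_on generalizing w with
  | _ n ih =>
    subst hn
    rcases mem_normalWords_or_reducible rules w hw with h | ⟨r, hr, u, v, rfl⟩
    · have hlen : w.length < 10 := by
        by_contra hlen
        simp [normalWords_eq_nil (not_lt.1 hlen)] at h
      obtain ⟨i, hi⟩ := List.mem_iff_get.1
        (List.mem_flatMap.2 ⟨_, List.mem_range.2 hlen, h⟩ : w ∈ basisWords)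
      exact Submodule.subset_span ⟨i, congrArg eval hi⟩
    · have hdec := List.all_eq_true.1 rules_decreasing r hr
      have h : eval (u ++ (r.lhs ++ v)) = (T r.exp : Rring) • eval (u ++ (r.rhs ++ v)) := by
        rw [eval_append, eval_append, show eval r.lhs = _ from rules_holds r hr, smul_mul_assoc,
          mul_smul_comm, ← eval_append, ← eval_append]
      rw [h]
      refine Submodule.smul_mem _ _ (ih _ (weight_rewrite_lt hdec u v) _ ?_ rfl)
      simp only [Rule.decreasing, Bool.and_eq_true, List.all_eq_true, Nat.blt_eq] at hdec
      simp only [List.mem_append] at hw ⊢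
      rintro g (hg | hg | hg)
      · exact hw g (.inl hg)
      · exact hdec.2 g hg
      · exact hw g (.inr (.inr hg))

theorem exists_eval_eq {a : BrB3} (ha : a ∈ Submonoid.closure (Set.range letter)) :
    ∃ w : List ℕ, (∀ g ∈ w, g < 6) ∧ eval w = a := by
  induction ha using Submonoid.closure_induction with
  | mem a ha =>
    obtain ⟨g, rfl⟩ := ha
    rcases lt_or_ge g 6 with hg | hg
    · exact ⟨[g], by simpa using hg, by simp [eval]⟩
    · obtain ⟨n, rfl⟩ := Nat.exists_eq_add_of_le' hg
      exact ⟨[5], by simp, by simp [eval, letter]⟩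
  | one => exact ⟨[], by simp, by simp [eval]⟩
  | mul a b _ _ iha ihb =>
    obtain ⟨u, hu, rfl⟩ := iha
    obtain ⟨v, hv, rfl⟩ := ihb
    refine ⟨u ++ v, fun g hg => ?_, eval_append u v⟩
    exact (List.mem_append.1 hg).elim (hu g) (hv g)

theorem adjoin_range_letter : Algebra.adjoin Rring (Set.range letter) = ⊤ := by
  rw [eq_top_iff, ← (AlgHom.range_eq_top _).2 (RingQuot.mkAlgHom_surjective Rring BrB3rel.rel),
    ← Algebra.map_top, ← FreeAlgebra.adjoin_range_ι, AlgHom.map_adjoin, ← Set.range_comp]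
  refine Algebra.adjoin_mono ?_
  rintro _ ⟨g | g, rfl⟩
  · fin_cases g
    exacts [⟨0, rfl⟩, ⟨1, rfl⟩, ⟨2, rfl⟩]
  · fin_cases g
    exacts [⟨3, rfl⟩, ⟨4, rfl⟩, ⟨5, rfl⟩]

/-- The irreducible words span `BrB3`. -/
theorem span_basisWords :
    Submodule.span Rring (Set.range fun i => eval (basisWords.get i)) = ⊤ := by
  rw [eq_top_iff, ← Algebra.top_toSubmodule, ← adjoin_range_letter, Algebra.adjoin_eq_span,
    Submodule.span_le]
  intro a ha
  obtain ⟨w, hw, rfl⟩ := exists_eval_eq ha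
  exact eval_mem_span w hw

end BrB3

/-! ### A monomial representation of `BrF4`

The left ideal of `BrF4` generated by `e₀ e₂` has `39` monomials up to powers of `δ`. The
letters `0, 1, 2, 3` stand for `r₀, r₁, r₂, r₃` and the letters `4, 5, 6, 7` for
`e₀, e₁, e₂, e₃`. -/

namespace BrF4

/-- The images of the `39` monomials under the letters. -/
def targets : List (List ℕ) :=
  [[0, 3, 2, 1, 4, 6, 5, 8, 7, 11, 10, 9, 12, 27, 28, 25, 29, 30, 31, 32, 26, 21, 22, 23, 24,
    15, 20, 13, 14, 16, 17, 18, 19, 33, 34, 35, 36, 37, 38],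
   [1, 0, 5, 3, 8, 2, 6, 7, 4, 10, 9, 11, 12, 35, 37, 24, 23, 34, 36, 38, 33, 21, 22, 16, 15,
    25, 26, 27, 28, 29, 30, 31, 32, 20, 17, 13, 18, 14, 19],
   [0, 9, 4, 11, 2, 15, 25, 29, 16, 1, 10, 3, 12, 14, 13, 5, 8, 17, 19, 18, 20, 22, 21, 24, 23,
    6, 26, 28, 27, 7, 30, 32, 31, 34, 33, 36, 35, 38, 37],
   [2, 5, 0, 6, 4, 1, 3, 7, 8, 13, 35, 27, 21, 9, 15, 14, 17, 16, 18, 20, 19, 12, 22, 34, 37,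
    28, 32, 11, 25, 30, 29, 31, 26, 38, 23, 10, 36, 24, 33],
   [0, 0, 2, 0, 4, 2, 2, 4, 4, 0, 0, 0, 0, 2, 4, 4, 2, 0, 4, 2, 0, 2, 4, 4, 2, 4, 0, 2, 4, 2, 0,
    4, 2, 2, 4, 2, 4, 0, 0],
   [3, 3, 6, 3, 7, 6, 6, 7, 7, 3, 3, 3, 3, 6, 7, 7, 6, 3, 7, 6, 3, 6, 7, 6, 7, 6, 6, 6, 3, 7, 7,
    7, 3, 3, 3, 6, 7, 7, 6],
   [0, 12, 0, 12, 0, 20, 26, 30, 17, 12, 10, 12, 12, 17, 17, 20, 17, 17, 20, 20, 20, 12, 12, 10,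
    10, 26, 26, 30, 30, 30, 30, 26, 26, 12, 12, 10, 10, 0, 0],
   [4, 8, 4, 7, 4, 8, 7, 7, 8, 18, 36, 31, 22, 18, 22, 22, 8, 8, 18, 18, 18, 22, 22, 4, 22, 22,
    31, 31, 22, 7, 7, 31, 31, 36, 4, 36, 36, 22, 36]]

/-- The powers of `δ` produced by the letters `4, 5, 6, 7`. -/
def exponents : List (List ℕ) :=
  [[2, 0, 2, 0, 2, 0, 0, 0, 0, 0, 1, 0, 1, 0, 0, 0, 0, 0, 0, 0, 0, 1, 1, 1, 1, 0, 0, 0, 0, 0, 0,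
    0, 0, 1, 1, 1, 1, 1, 1],
   [0, 0, 0, 2, 0, 0, 2, 2, 0, 0, 0, 1, 1, 0, 0, 0, 0, 0, 0, 0, 0, 1, 1, 0, 0, 1, 1, 1, 1, 1, 1,
    1, 1, 0, 0, 0, 0, 0, 0],
   [1, 0, 0, 0, 0, 0, 0, 0, 0, 0, 1, 0, 1, 0, 0, 0, 0, 1, 0, 0, 1, 0, 0, 0, 0, 0, 1, 0, 0, 0, 1,
    0, 0, 0, 0, 0, 0, 0, 0],
   [0, 0, 0, 0, 1, 0, 0, 1, 1, 0, 0, 0, 0, 0, 0, 0, 0, 0, 1, 0, 0, 0, 1, 0, 0, 0, 0, 0, 0, 0, 0,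
    1, 0, 0, 0, 0, 1, 0, 0]]

/-- The action of a letter on monomials with a power of `δ` as coefficient. -/
def step (g : ℕ) (p : Fin 39 × ℤ) : Fin 39 × ℤ :=
  (Fin.ofNat 39 ((targets.getD g []).getD p.1.val 0),
    p.2 + Int.ofNat (bif g.blt 4 then 0 else (exponents.getD (g - 4) []).getD p.1.val 0))

/-- The action of a word. -/
def run (w : List ℕ) (p : Fin 39 × ℤ) : Fin 39 × ℤ := w.foldr step p

theorem step_add (g : ℕ) (x : Fin 39) (m n : ℤ) :
    step g (x, m + n) = ((step g (x, m)).1, (step g (x, m)).2 + n) := by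
  simp only [step, Prod.mk.injEq, true_and]
  ring

theorem run_add (w : List ℕ) (x : Fin 39) (m n : ℤ) :
    run w (x, m + n) = ((run w (x, m)).1, (run w (x, m)).2 + n) := by
  induction w with
  | nil => rfl
  | cons g w ih => exact (congrArg (step g) ih).trans (step_add ..)

theorem run_eq (w : List ℕ) (p : Fin 39 × ℤ) :
    run w p = ((run w (p.1, 0)).1, (run w (p.1, 0)).2 + p.2) := by
  simpa using run_add w p.1 0 p.2

/-- Triples of monomials with coefficients, up to a common power of `δ`; the coefficient of the
first one is normalised to `1`. -/
abbrev Triple : Type := Fin 39 × (Fin 2 → Fin 39 × ℤ)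

/-- The diagonal action of a word on triples. -/
def runTriple (w : List ℕ) (z : Triple) : Triple :=
  ((run w (z.1, 0)).1, fun i => ((run w (z.2 i)).1, (run w (z.2 i)).2 - (run w (z.1, 0)).2))

/-- The diagonal action of a word on the free module on all triples. -/
noncomputable def runLin (w : List ℕ) : Module.End Rring (Triple →₀ Rring) :=
  Finsupp.linearCombination Rring fun z =>
    Finsupp.single (runTriple w z) (T (run w (z.1, 0)).2)

theorem runLin_single (w : List ℕ) (z : Triple) (a : Rring) :
    runLin w (Finsupp.single z a) =
      Finsupp.single (runTriple w z) (a * T (run w (z.1, 0)).2) := by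
  simp [runLin]

theorem runLin_append (u w : List ℕ) : runLin (u ++ w) = runLin u * runLin w := by
  have hrun : ∀ p, run (u ++ w) p = run u (run w p) := fun p => List.foldr_append
  refine Finsupp.lhom_ext fun z a => ?_
  rw [Module.End.mul_apply, runLin_single, runLin_single, runLin_single, mul_assoc, ← T_add, hrun,
    run_eq u (run w (z.1, 0)), add_comm (run w (z.1, 0)).2]
  congr 1
  refine Prod.ext ?_ (funext fun i => ?_)
  · simp only [runTriple, hrun]
    rw [run_eq u (run w (z.1, 0))]
  · simp only [runTriple, hrun]
    rw [run_eq u (run w (z.1, 0)), run_eq u (run w (z.2 i)),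
      run_eq u ((run w (z.2 i)).1, (run w (z.2 i)).2 - (run w (z.1, 0)).2)]
    refine Prod.ext rfl ?_
    simp only
    ring

theorem runLin_nil : runLin [] = 1 :=
  Finsupp.lhom_ext fun z a => by simp [runLin_single, runTriple, run]

theorem runLin_eq_prod (w : List ℕ) : runLin w = (w.map fun g => runLin [g]).prod := by
  induction w with
  | nil => exact runLin_nil
  | cons g w ih => rw [List.map_cons, List.prod_cons, ← ih, ← runLin_append, List.singleton_append]

/-- Words acting in the same way up to `δ ^ k` give the same linear maps up to `δ ^ k`. -/
theorem runLin_eq_smul {u w : List ℕ} {k : ℤ}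
    (h : ∀ x, run u (x, 0) = ((run w (x, 0)).1, (run w (x, 0)).2 + k)) :
    runLin u = (T k : Rring) • runLin w := by
  have h' : ∀ p, run u p = ((run w p).1, (run w p).2 + k) := fun p => by
    rw [run_eq u, run_eq w, h]
    exact Prod.ext rfl (by simp only; ring)
  refine Finsupp.lhom_ext fun z a => ?_
  rw [LinearMap.smul_apply, runLin_single, runLin_single, Finsupp.smul_single, smul_eq_mul, h',
    add_comm, T_add, mul_left_comm]
  congr 1
  refine Prod.ext ?_ (funext fun i => Prod.ext ?_ ?_) <;> simp [runTriple, h']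

/-- The linear map associated with a generator of `BrF4`. -/
noncomputable def genLin : GenF4 → Module.End Rring (Triple →₀ Rring)
  | .r i => runLin [i]
  | .e i => runLin [i + 4]

theorem lift_genLin_rel {a b : FreeAlgebra Rring GenF4} (h : BrF4rel.rel a b) :
    FreeAlgebra.lift Rring genLin a = FreeAlgebra.lift Rring genLin b := by
  have key : ∀ (u w : List ℕ) (k : ℤ),
      (∀ x, run u (x, 0) = ((run w (x, 0)).1, (run w (x, 0)).2 + k)) →
      (u.map fun g => runLin [g]).prod = (T k : Rring) • (w.map fun g => runLin [g]).prod :=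
    fun u w k h => by rw [← runLin_eq_prod, ← runLin_eq_prod, runLin_eq_smul h]
  have hδ : (T 2 : Rring) = δ ^ 2 := by simp [δ, T_pow]
  have hδ' : (T 1 : Rring) = δ := rfl
  have hmul : ∀ x y : FreeAlgebra Rring GenF4, FreeAlgebra.lift Rring genLin (x * y) =
    FreeAlgebra.lift Rring genLin x * FreeAlgebra.lift Rring genLin y := fun x y => map_mul _ x y
  cases h with
  | rr i =>
    have := key [i, i] [] 0 (by revert i; decide +kernel)
    simpa [genLin, hmul] using this
  | re i =>
    have := key [i, i + 4] [i + 4] 0 (by revert i; decide +kernel)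
    simpa [genLin] using this
  | er i =>
    have := key [i + 4, i] [i + 4] 0 (by revert i; decide +kernel)
    simpa [genLin] using this
  | ee_short i h =>
    have := key [i + 4, i + 4] [i + 4] 1 (by revert i; decide +kernel)
    simpa [genLin, hδ'] using this
  | ee_long i h =>
    have := key [i + 4, i + 4] [i + 4] 2 (by revert i; decide +kernel)
    simpa [genLin, hδ] using this
  | @rr_comm i j h =>
    have := key [i, j] [j, i] 0 (by revert i j; unfold BrF4rel.nadj; decide +kernel)
    simpa [genLin] using this
  | @er_comm i j h =>
    have := key [i + 4, j] [j, i + 4] 0 (by revert i j; unfold BrF4rel.nadj; decide +kernel)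
    simpa [genLin] using this
  | @ee_comm i j h =>
    have := key [i + 4, j + 4] [j + 4, i + 4] 0
      (by revert i j; unfold BrF4rel.nadj; decide +kernel)
    simpa [genLin] using this
  | @braid i j h =>
    have := key [i, j, i] [j, i, j] 0 (by revert i j; unfold BrF4rel.sadj; decide +kernel)
    simpa [genLin, mul_assoc] using this
  | @rre i j h =>
    have := key [j, i, j + 4] [i + 4, j + 4] 0
      (by revert i j; unfold BrF4rel.sadj; decide +kernel)
    simpa [genLin, mul_assoc] using this
  | @rer i j h =>
    have := key [i, j + 4, i] [j, i + 4, j] 0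
      (by revert i j; unfold BrF4rel.sadj; decide +kernel)
    simpa [genLin, mul_assoc] using this
  | db1 =>
    have := key [1, 2, 1, 2] [2, 1, 2, 1] 0 (by decide +kernel)
    simpa [genLin, mul_assoc] using this
  | db2 =>
    have := key [1, 2, 5] [2, 5] 0 (by decide +kernel)
    simpa [genLin, mul_assoc] using this
  | db3 =>
    have := key [1, 6, 1, 6] [6, 5, 6] 0 (by decide +kernel)
    simpa [genLin, mul_assoc] using this
  | db4 =>
    have := key [1, 2, 1, 6] [6, 1, 2, 1] 0 (by decide +kernel)
    simpa [genLin, mul_assoc] using this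
  | db5 =>
    have := key [5, 2, 5] [5] 1 (by decide +kernel)
    simpa [genLin, mul_assoc, hδ'] using this
  | db6 =>
    have := key [5, 6, 5] [5] 1 (by decide +kernel)
    simpa [genLin, mul_assoc, hδ'] using this
  | db7 =>
    have := key [5, 2, 1] [5, 2] 0 (by decide +kernel)
    simpa [genLin, mul_assoc] using this
  | db8 =>
    have := key [5, 6, 1] [5, 6] 0 (by decide +kernel)
    simpa [genLin, mul_assoc] using this

/-- The representation of `BrF4` on the free module on triples. -/
noncomputable def rep : BrF4 →ₐ[Rring] Module.End Rring (Triple →₀ Rring) :=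
  RingQuot.liftAlgHom Rring ⟨FreeAlgebra.lift Rring genLin, fun _ _ h => lift_genLin_rel h⟩

theorem rep_rgen (i : Fin 4) : rep (rgen i) = runLin [i.val] := by
  simp [rep, rgen, genLin]

theorem rep_egen (i : Fin 4) : rep (egen i) = runLin [i.val + 4] := by
  simp [rep, egen, genLin]

end BrF4

/-! ### The canonical homomorphism -/

namespace BrB3

/-- The canonical homomorphism on the free algebra. -/
noncomputable def toBrF4Gen : GenB3 → BrF4
  | .x i => rgen i.succ
  | .f i => egen i.succ

theorem lift_toBrF4Gen_rel {a b : FreeAlgebra Rring GenB3} (h : BrB3rel.rel a b) :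
    FreeAlgebra.lift Rring toBrF4Gen a = FreeAlgebra.lift Rring toBrF4Gen b := by
  have hF := fun {a b} => @RingQuot.mkAlgHom_rel Rring _ _ _ _ BrF4rel.rel a b
  have hX : ∀ i, FreeAlgebra.lift Rring toBrF4Gen (BrB3rel.X i) =
    RingQuot.mkAlgHom Rring BrF4rel.rel (BrF4rel.R i.succ) := fun i => FreeAlgebra.lift_ι_apply ..
  have hE : ∀ i, FreeAlgebra.lift Rring toBrF4Gen (BrB3rel.F i) =
    RingQuot.mkAlgHom Rring BrF4rel.rel (BrF4rel.E i.succ) := fun i => FreeAlgebra.lift_ι_apply ..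
  cases h <;> simp only [map_mul, map_one, map_smul, hX, hE] <;>
    simp only [← map_mul, ← map_smul, ← map_one (RingQuot.mkAlgHom Rring BrF4rel.rel)]
  case xx i => exact hF (.rr _)
  case xf i => exact hF (.re _)
  case fx i => exact hF (.er _)
  case ff_short1 => exact hF (.ee_short _ (.inl rfl))
  case ff_short2 => exact hF (.ee_short _ (.inr rfl))
  case ff_long => exact hF (.ee_long _ (.inr rfl))
  case nxx => exact hF (.rr_comm (by simp [BrF4rel.nadj]))
  case nfx => exact hF (.er_comm (by simp [BrF4rel.nadj]))
  case nxf => exact hF (.er_comm (by simp [BrF4rel.nadj]))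
  case nff => exact hF (.ee_comm (by simp [BrF4rel.nadj]))
  case braid => exact hF (.braid (by simp [BrF4rel.sadj]))
  case rre12 => exact hF (.rre (by simp [BrF4rel.sadj]))
  case rre21 => exact hF (.rre (by simp [BrF4rel.sadj]))
  case rer12 => exact hF (.rer (by simp [BrF4rel.sadj]))
  case db1 => exact hF .db1
  case db2 => exact hF .db2
  case db3 => exact hF .db3
  case db4 => exact hF .db4
  case db5 => exact hF .db5
  case db6 => exact hF .db6
  case db7 => exact hF .db7
  case db8 => exact hF .db8

/-- The canonical homomorphism from `BrB3` to `BrF4`. -/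
noncomputable def toBrF4 : BrB3 →ₐ[Rring] BrF4 :=
  RingQuot.liftAlgHom Rring ⟨FreeAlgebra.lift Rring toBrF4Gen, fun _ _ h => lift_toBrF4Gen_rel h⟩

theorem toBrF4_xgen (i : Fin 3) : toBrF4 (xgen i) = rgen i.succ := by
  simp [toBrF4, xgen, toBrF4Gen]

theorem toBrF4_fgen (i : Fin 3) : toBrF4 (fgen i) = egen i.succ := by
  simp [toBrF4, fgen, toBrF4Gen]

/-- The letter of `BrF4` corresponding to a letter of `BrB3`. -/
def embed (g : ℕ) : ℕ := bif g.blt 3 then g + 1 else (min g 5) + 2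

theorem rep_toBrF4_letter (g : ℕ) : BrF4.rep (toBrF4 (letter g)) = BrF4.runLin [embed g] := by
  rcases g with _ | _ | _ | _ | _ | g
  · exact (congrArg _ (toBrF4_xgen 0)).trans (BrF4.rep_rgen _)
  · exact (congrArg _ (toBrF4_xgen 1)).trans (BrF4.rep_rgen _)
  · exact (congrArg _ (toBrF4_xgen 2)).trans (BrF4.rep_rgen _)
  · exact (congrArg _ (toBrF4_fgen 0)).trans (BrF4.rep_egen _)
  · exact (congrArg _ (toBrF4_fgen 1)).trans (BrF4.rep_egen _)
  · have h : embed (g + 5) = 7 := by simp [embed, Nat.blt, Nat.ble]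
    exact ((congrArg _ (toBrF4_fgen 2)).trans (BrF4.rep_egen _)).trans (by rw [h]; rfl)

theorem rep_toBrF4_eval (w : List ℕ) :
    BrF4.rep (toBrF4 (eval w)) = BrF4.runLin (w.map embed) := by
  rw [BrF4.runLin_eq_prod, eval, map_list_prod, map_list_prod, List.map_map, List.map_map,
    List.map_map]
  congr 2
  exact funext rep_toBrF4_letter

/-- A triple whose images under the irreducible words are pairwise distinct. -/
def baseTriple : BrF4.Triple := (0, ![(1, 0), (2, 0)])

/-- A numerical encoding of triples. -/
def code (z : BrF4.Triple) : ℕ :=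
  ((((z.2 1).2 + 10).toNat * 20 + ((z.2 0).2 + 10).toNat) * 39 + (z.2 1).1.val) * 39 * 39 +
    (z.2 0).1.val * 39 + z.1.val

theorem nodup_code :
    (basisWords.map fun w => code (BrF4.runTriple (w.map embed) baseTriple)).Nodup := by
  decide +kernel

theorem runTriple_injective : Function.Injective fun i =>
    BrF4.runTriple ((basisWords.get i).map embed) baseTriple := by
  intro i j hij
  have h := List.nodup_iff_injective_get.1 nodup_code
  have hc := congrArg code hij
  have := @h (i.cast (List.length_map _).symm) (j.cast (List.length_map _).symm) (by simpa using hc)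
  simpa using this

theorem eq_zero_of_sum_single_eq_zero {ι α : Type*} [Fintype ι] {z : ι → α}
    (hz : Function.Injective z) {k : ι → ℤ} {c : ι → Rring}
    (h : ∑ i, Finsupp.single (z i) (c i * T (k i)) = 0) (j : ι) : c j = 0 := by
  have hj := DFunLike.congr_fun h (z j)
  rw [Finsupp.finsetSum_apply, Finset.sum_eq_single j, Finsupp.single_eq_same,
    Finsupp.zero_apply] at hj
  · exact (isUnit_T _).mul_left_eq_zero.1 hj
  · exact fun i _ hi => Finsupp.single_eq_of_ne fun hij => hi (hz hij.symm)
  · exact fun hj => absurd (Finset.mem_univ j) hj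

theorem toBrF4_injective : Function.Injective toBrF4 := by
  rw [injective_iff_map_eq_zero]
  intro a ha
  obtain ⟨c, rfl⟩ := (Submodule.mem_span_range_iff_exists_fun Rring).1
    (span_basisWords ▸ Submodule.mem_top : a ∈ _)
  have h := congrArg (fun b => BrF4.rep b (Finsupp.single baseTriple 1)) ha
  simp only [map_sum, map_smul, rep_toBrF4_eval, LinearMap.sum_apply, LinearMap.smul_apply,
    BrF4.runLin_single, map_zero, LinearMap.zero_apply, one_mul, Finsupp.smul_single,
    smul_eq_mul] at h
  simp [eq_zero_of_sum_single_eq_zero runTriple_injective h]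

end BrB3

/-- The canonical homomorphism `Br(B₃) → Br(F₄)`, `x_i ↦ r_i`, `f_i ↦ e_i`
(`i = 2,3,4`), is injective. -/
theorem brB3_to_brF4_injective :
    ∃ ψ : BrB3 →ₐ[Rring] BrF4,
      (∀ i : Fin 3, ψ (xgen i) = rgen (Fin.succ i)) ∧
      (∀ i : Fin 3, ψ (fgen i) = egen (Fin.succ i)) ∧
      Function.Injective ψ := by
  exact ⟨BrB3.toBrF4, BrB3.toBrF4_xgen, BrB3.toBrF4_fgen, BrB3.toBrF4_injective⟩
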